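/- For every k ≥ 1, the restriction of the growth derivation N to the degree-k homogeneous component of Kreimer's Hopf algebra H_K is injective (as a map into the degree-(k+1) component), and the restriction of the pruning derivation P to the degree-k component is surjective onto the degree-(k−1) component. -/

import Mathlib

attribute [local instance] Classical.propDecidable

inductive PlanarTree : Type where
  | node : List PlanarTree → PlanarTree

namespace PlanarTree

/-- Isomorphism of (planar representatives of) rooted trees: the lists of
principal branches match up, pairwise isomorphically, after a permutation. -/
inductive Iso : PlanarTree → PlanarTree → Prop where
  | node {l m l' : List PlanarTree} :
      List.Perm l m → List.Forall₂ Iso m l' → Iso (node l) (node l')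

/-- Number of vertices. -/
def size : PlanarTree → ℕ
  | node l => 1 + (l.attach.map fun c => size c.1).sum
decreasing_by simp only [PlanarTree.node.sizeOf_spec]; exact Nat.lt_of_lt_of_le (List.sizeOf_lt_of_mem c.2) (Nat.le_add_left _ _)

mutual
  /-- All trees obtained by attaching the root of `s` by a new edge to some vertex. -/
  def graftList (s : PlanarTree) : PlanarTree → List PlanarTree
    | node l => node (s :: l) :: (graftAux s l).map node
  def graftAux (s : PlanarTree) : List PlanarTree → List (List PlanarTree)
    | [] => []
    | a :: l => ((graftList s a).map (· :: l)) ++ (graftAux s l).map (a :: ·)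
end

/-- All trees obtained by adding a new edge and terminal vertex at some vertex. -/
def growList (t : PlanarTree) : List PlanarTree := graftList (node []) t

mutual
  /-- All trees obtained by deleting one (non-root) terminal vertex. -/
  def pruneList : PlanarTree → List PlanarTree
    | node l => (pruneAux l).map node
  def pruneAux : List PlanarTree → List (List PlanarTree)
    | [] => []
    | a :: l =>
        (match a with | node [] => [l] | _ => []) ++
        ((pruneList a).map (· :: l)) ++ (pruneAux l).map (a :: ·)
end

mutual
  /-- All pairs (cut-off subtree, remaining tree) obtained by cutting one edge. -/
  def cutPairs : PlanarTree → List (PlanarTree × PlanarTree)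
    | node l => (cutAux l).map fun x => (x.1, node x.2)
  def cutAux : List PlanarTree → List (PlanarTree × List PlanarTree)
    | [] => []
    | a :: l =>
        (a, l) :: (((cutPairs a).map fun x => (x.1, x.2 :: l)) ++
          (cutAux l).map fun x => (x.1, a :: x.2))
end

/-- The order of the symmetry group `SG(t)`: the product over all vertices `v`
of the number of permutations of the branches at `v` exchanging isomorphic branches. -/
noncomputable def sg : PlanarTree → ℕ
  | node l =>
      (l.attach.map fun c => sg c.1).prod *
        Nat.card {σ : Equiv.Perm (Fin l.length) // ∀ i, Iso (l.get (σ i)) (l.get i)}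
decreasing_by simp only [PlanarTree.node.sizeOf_spec]; exact Nat.lt_of_lt_of_le (List.sizeOf_lt_of_mem c.2) (Nat.le_add_left _ _)

/-- Vertices of a planar tree, encoded as paths of child-indices from the root. -/
inductive IsVertex : PlanarTree → List ℕ → Prop where
  | root (t : PlanarTree) : IsVertex t []
  | child {l : List PlanarTree} {i : ℕ} {c : PlanarTree} {p : List ℕ} :
      l[i]? = some c → IsVertex c p → IsVertex (node l) (i :: p)

def Vertex (t : PlanarTree) : Type := {p : List ℕ // IsVertex t p}

/-- `v` lies strictly below `w` in the tree order (i.e. `w` is a proper ancestor of `v`). -/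
def StrictBelow {t : PlanarTree} (v w : Vertex t) : Prop := w.1 <+: v.1 ∧ w.1 ≠ v.1

/-- A labelling of `t`. -/
def Labelling (t : PlanarTree) : Type :=
  {f : Vertex t ≃ Fin t.size // ∀ v w, StrictBelow v w → f w < f v}

/-- Equivalence of labellings: they differ by an automorphism of the rooted tree. -/
def labelEquiv {t : PlanarTree} (f g : Labelling t) : Prop :=
  ∃ φ : Equiv.Perm (Vertex t),
    (∀ v w, StrictBelow (φ v) (φ w) ↔ StrictBelow v w) ∧ ∀ v, f.1 (φ v) = g.1 v

end PlanarTree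

/-- Rooted trees: isomorphism classes of planar rooted trees. -/
instance planarSetoid : Setoid PlanarTree := Relation.EqvGen.setoid PlanarTree.Iso

def RTree : Type := Quotient planarSetoid

namespace RTree

def mk (p : PlanarTree) : RTree := ⟦p⟧

/-- A chosen planar representative. -/
noncomputable def rep (T : RTree) : PlanarTree := Quotient.out T

noncomputable def size (T : RTree) : ℕ := T.rep.size

/-- The order of the symmetry (automorphism) group of `T`. -/
noncomputable def sg (T : RTree) : ℕ := T.rep.sg

/-- The one-vertex tree. -/
def bullet : RTree := mk (PlanarTree.node [])

/-- `Covers T T'` means `T ⊲ T'`: `T` is obtained from `T'` by deleting one terminal vertex. -/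
noncomputable def Covers (T T' : RTree) : Prop :=
  ∃ p ∈ T'.rep.pruneList, mk p = T

/-- `n(T;T')`: the number of vertices of `T` to which a new edge can be added to obtain `T'`. -/
noncomputable def nCov (T T' : RTree) : ℕ :=
  T.rep.growList.countP fun p => decide (mk p = T')

/-- `m(T;T')`: the number of (terminal) edges of `T'` which when removed leave `T`. -/
noncomputable def mCov (T T' : RTree) : ℕ :=
  T'.rep.pruneList.countP fun p => decide (mk p = T)

/-- `n(T₁,T₂;T₃)`: the number of vertices of `T₂` such that attaching the root of `T₁`
there by a new edge yields `T₃`. -/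
noncomputable def nTri (T₁ T₂ T₃ : RTree) : ℕ :=
  (PlanarTree.graftList T₁.rep T₂.rep).countP fun p => decide (mk p = T₃)

/-- `m(T₁,T₂;T₃)`: the number of edges of `T₃` whose removal cuts off a subtree
isomorphic to `T₁` leaving `T₂` (the piece containing the root). -/
noncomputable def mTri (T₁ T₂ T₃ : RTree) : ℕ :=
  T₃.rep.cutPairs.countP fun x => decide (mk x.1 = T₁ ∧ mk x.2 = T₂)

end RTree

section Ops

variable (k : Type*) [Semiring k]

/-- The element `𝔑(T) = Σ_{T ⊲ T'} n(T;T')·T'` of `k{T}`. -/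
noncomputable def growF (T : RTree) : RTree →₀ k :=
  (T.rep.growList.map fun p => Finsupp.single (RTree.mk p) (1 : k)).sum

/-- The element `𝔓(T) = Σ_{T' ⊲ T} m(T';T)·T'` of `k{T}`. -/
noncomputable def pruneF (T : RTree) : RTree →₀ k :=
  (T.rep.pruneList.map fun p => Finsupp.single (RTree.mk p) (1 : k)).sum

/-- The growth operator `𝔑` on `k{T}`. -/
noncomputable def Grow : Module.End k (RTree →₀ k) :=
  Finsupp.linearCombination k (growF k)

/-- The pruning operator `𝔓` on `k{T}`. -/
noncomputable def Prune : Module.End k (RTree →₀ k) :=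
  Finsupp.linearCombination k (pruneF k)

/-- The operator `𝔇` on `k{T}`, `𝔇(t) = |t|·t`. -/
noncomputable def Diag : Module.End k (RTree →₀ k) :=
  Finsupp.linearCombination k fun T => (T.size : k) • Finsupp.single T 1

/-- The inner product on `k{T}` determined by `(t,t') = |SG(t)|·δ_{t,t'}`. -/
noncomputable def innerT (x y : RTree →₀ k) : k :=
  x.sum fun T c => c * y T * (T.sg : k)

/-- Generalized multiplicity `n(T;T')`: coefficient of `T'` in `𝔑^{|T'|-|T|}(T)`. -/
noncomputable def nGen (T T' : RTree) : k :=
  ((Grow k ^ (T'.size - T.size)) (Finsupp.single T 1)) T'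

/-- Generalized multiplicity `m(T;T')`: coefficient of `T` in `𝔓^{|T'|-|T|}(T')`. -/
noncomputable def mGen (T T' : RTree) : k :=
  ((Prune k ^ (T'.size - T.size)) (Finsupp.single T' 1)) T

end Ops

section Kreimer

variable (k : Type*) [CommSemiring k]

/-- Kreimer's Hopf algebra `H_K`, as a commutative algebra: the free polynomial
algebra on rooted trees. -/
abbrev HK := MvPolynomial RTree k

/-- The inclusion `k{T} → H_K` of the linear span of the variables. -/
noncomputable def toHK : (RTree →₀ k) →ₗ[k] HK k :=
  Finsupp.linearCombination k fun T => MvPolynomial.X T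

/-- The growth derivation `N` on `H_K`, with `N(t) = 𝔑(t)` for rooted trees `t`. -/
noncomputable def ND : Derivation k (HK k) (HK k) :=
  MvPolynomial.mkDerivation k fun T => toHK k (growF k T)

/-- The pruning derivation `P` on `H_K`, with `P(t) = 𝔓(t)` for `|t| ≥ 2`, `P(•) = 1`. -/
noncomputable def PD : Derivation k (HK k) (HK k) :=
  MvPolynomial.mkDerivation k fun T =>
    if T = RTree.bullet then 1 else toHK k (pruneF k T)

/-- The grading derivation `D` on `H_K`, multiplying each homogeneous element of
degree `n` by `n`; it is the derivation with `D(t) = |t|·t` for rooted trees `t`. -/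
noncomputable def DD : Derivation k (HK k) (HK k) :=
  MvPolynomial.mkDerivation k fun T => (T.size : k) • MvPolynomial.X T

/-- The map `B₊ : H_K → k{T}` sending a forest to the tree obtained by attaching
all its roots to a new root vertex. -/
noncomputable def forestTree (d : RTree →₀ ℕ) : RTree :=
  RTree.mk (PlanarTree.node
    (d.support.toList.flatMap fun T => List.replicate (d T) T.rep))

noncomputable def Bplus (p : HK k) : RTree →₀ k :=
  ∑ d ∈ p.support, Finsupp.single (forestTree d) (MvPolynomial.coeff d p)

/-- The inner product on `H_K`. -/
noncomputable def innerHK (u v : HK k) : k := innerT k (Bplus k u) (Bplus k v)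

/-- The degree-`n` homogeneous component of `H_K`. -/
noncomputable abbrev HKcomp (n : ℕ) : Submodule k (HK k) :=
  MvPolynomial.weightedHomogeneousSubmodule k (fun T : RTree => T.size) n

/-- `T_i`: the number of rooted trees with `i+1` vertices. -/
noncomputable def Tcard (i : ℕ) : ℕ := Nat.card {T : RTree // T.size = i + 1}

end Kreimer

namespace PlanarTree

theorem node_induction {p : PlanarTree → Prop}
    (h : ∀ l, (∀ a ∈ l, p a) → p (node l)) : ∀ t, p t
  | node l => h l fun a _ => node_induction h a
decreasing_by
  simp only [PlanarTree.node.sizeOf_spec]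
  exact Nat.lt_of_lt_of_le (List.sizeOf_lt_of_mem ‹_›) (Nat.le_add_left _ _)

theorem size_node (l : List PlanarTree) : (node l).size = 1 + (l.map size).sum := by
  rw [size]
  exact congrArg (fun x : List ℕ => 1 + x.sum) List.attach_map_val

theorem size_pos (t : PlanarTree) : 1 ≤ t.size := by
  cases t
  rw [size_node]
  omega

theorem size_lt_of_mem {l : List PlanarTree} {a : PlanarTree} (h : a ∈ l) :
    a.size < (node l).size := by
  have := List.single_le_sum (by simp) _ (List.mem_map_of_mem (f := size) h)
  rw [size_node]
  omega

theorem Iso.refl (t : PlanarTree) : Iso t t := by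
  induction t using node_induction with
  | h l ih => exact .node (List.Perm.refl l) (List.forall₂_same.2 ih)

theorem Iso.size_eq {s : PlanarTree} : ∀ {t : PlanarTree}, Iso s t → s.size = t.size := by
  induction s using node_induction with
  | h l ih =>
    rintro _ ⟨hp, hf⟩
    rename_i m l'
    rw [size_node, size_node, (hp.map size).sum_eq]
    have ih' : ∀ a ∈ m, ∀ {t : PlanarTree}, Iso a t → a.size = t.size :=
      fun a ha => ih a (hp.mem_iff.2 ha)
    clear ih hp
    congr 2
    induction hf with
    | nil => rfl
    | cons h _ ih₂ =>
      rw [List.map_cons, List.map_cons, ih' _ (by simp) h,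
        ih₂ fun a ha => ih' a (List.mem_cons_of_mem _ ha)]

/-- The isomorphism classes of the principal branches. -/
def branches : PlanarTree → Multiset RTree
  | node l => (l.map RTree.mk : List RTree)

theorem Iso.branches_eq {s t : PlanarTree} (h : Iso s t) : s.branches = t.branches := by
  obtain ⟨hp, hf⟩ := h
  rename_i m l'
  rw [branches, branches, Multiset.coe_eq_coe]
  refine (hp.map _).trans (.of_eq ?_)
  clear hp
  induction hf with
  | nil => rfl
  | cons h _ ih => rw [List.map_cons, List.map_cons, ih,
      show RTree.mk _ = RTree.mk _ from Quotient.sound (.rel _ _ h)]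

theorem mk_node_append_congr (u v : List PlanarTree) {a b : PlanarTree}
    (h : RTree.mk a = RTree.mk b) :
    RTree.mk (node (u ++ a :: v)) = RTree.mk (node (u ++ b :: v)) := by
  have h' : Relation.EqvGen Iso a b := Quotient.exact h
  clear h
  induction h' with
  | rel x y h =>
    refine Quotient.sound (.rel _ _ (.node (List.Perm.refl _) ?_))
    exact List.rel_append (List.forall₂_same.2 fun c _ => Iso.refl c)
      (.cons h (List.forall₂_same.2 fun c _ => Iso.refl c))
  | refl => rfl
  | symm _ _ _ ih => exact ih.symm
  | trans _ _ _ _ _ ih₁ ih₂ => exact ih₁.trans ih₂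

theorem mk_node_eq_of_map_eq (u : List PlanarTree) :
    ∀ {l m : List PlanarTree}, l.map RTree.mk = m.map RTree.mk →
      RTree.mk (node (u ++ l)) = RTree.mk (node (u ++ m)) := by
  intro l
  induction l generalizing u with
  | nil =>
    intro m h
    rw [List.map_nil, eq_comm, List.map_eq_nil_iff] at h
    rw [h]
  | cons a l ih =>
    rintro (_ | ⟨b, m⟩) h
    · simp at h
    · rw [List.map_cons, List.map_cons, List.cons.injEq] at h
      rw [mk_node_append_congr u l h.1]
      simpa using ih (u ++ [b]) h.2

theorem mk_node_eq_iff {l m : List PlanarTree} :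
    RTree.mk (node l) = RTree.mk (node m) ↔ (l.map RTree.mk).Perm (m.map RTree.mk) := by
  constructor
  · intro h
    have h' : Relation.EqvGen Iso (node l) (node m) := Quotient.exact h
    suffices ∀ s t, Relation.EqvGen Iso s t → s.branches = t.branches from
      Multiset.coe_eq_coe.1 (this _ _ h')
    intro s t h
    induction h with
    | rel x y h => exact h.branches_eq
    | refl => rfl
    | symm _ _ _ ih => exact ih.symm
    | trans _ _ _ _ _ ih₁ ih₂ => exact ih₁.trans ih₂
  · intro h
    obtain ⟨l', hl', hl⟩ := (congrFun₂ (List.eq_map_comp_perm RTree.mk) (l.map RTree.mk) m).mpr h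
    refine (mk_node_eq_of_map_eq [] hl').trans (Quotient.sound (.rel _ _ (.node hl ?_)))
    exact List.forall₂_same.2 fun c _ => Iso.refl c

theorem mk_eq_bullet_iff {l : List PlanarTree} :
    RTree.mk (node l) = RTree.bullet ↔ l = [] := by
  rw [RTree.bullet, mk_node_eq_iff]
  simp

theorem size_of_mem_graftList {s t : PlanarTree} :
    ∀ q ∈ graftList s t, q.size = t.size + s.size := by
  induction t using node_induction with
  | h l ih =>
    intro q hq
    rw [graftList, List.mem_cons, List.mem_map] at hq
    rcases hq with rfl | ⟨m, hm, rfl⟩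
    · rw [size_node, size_node, List.map_cons, List.sum_cons]
      omega
    · rw [size_node, size_node]
      suffices (m.map size).sum = (l.map size).sum + s.size by omega
      induction l generalizing m with
      | nil => simp [graftAux] at hm
      | cons a l ihl =>
        simp only [graftAux, List.mem_append, List.mem_map] at hm
        rcases hm with ⟨b, hb, rfl⟩ | ⟨m', hm', rfl⟩
        · have := ih a (by simp) b hb
          simp only [List.map_cons, List.sum_cons]
          omega
        · have := ihl (fun a ha => ih a (List.mem_cons_of_mem _ ha)) _ hm'
          simp only [List.map_cons, List.sum_cons]
          omega

theorem pruneAux_cons (a : PlanarTree) (l : List PlanarTree) :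
    pruneAux (a :: l) = (if RTree.mk a = RTree.bullet then [l] else []) ++
      a.pruneList.map (· :: l) ++ (pruneAux l).map (a :: ·) := by
  obtain ⟨_ | ⟨b, m⟩⟩ := a <;> simp [pruneAux, mk_eq_bullet_iff]

theorem size_of_mem_pruneList {t : PlanarTree} : ∀ q ∈ pruneList t, q.size + 1 = t.size := by
  induction t using node_induction with
  | h l ih =>
    intro q hq
    rw [pruneList, List.mem_map] at hq
    obtain ⟨m, hm, rfl⟩ := hq
    rw [size_node, size_node]
    suffices (m.map size).sum + 1 = (l.map size).sum by omega
    induction l generalizing m with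
    | nil => simp [pruneAux] at hm
    | cons a l ihl =>
      simp only [pruneAux_cons, List.mem_append, List.mem_map] at hm
      rcases hm with (hm | ⟨b, hb, rfl⟩) | ⟨m', hm', rfl⟩
      · obtain ⟨c⟩ := a
        split_ifs at hm with hc
        · rw [mk_eq_bullet_iff] at hc
          rw [List.mem_singleton] at hm
          subst hc hm
          simp only [List.map_cons, List.sum_cons, size_node, List.map_nil, List.sum_nil]
          omega
        · simp at hm
      · have := ih a (by simp) b hb
        simp only [List.map_cons, List.sum_cons]
        omega
      · have := ihl (fun a ha => ih a (List.mem_cons_of_mem _ ha)) _ hm'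
        simp only [List.map_cons, List.sum_cons]
        omega

end PlanarTree

namespace RTree

theorem mk_rep (T : RTree) : mk T.rep = T := Quotient.out_eq T

theorem size_mk (t : PlanarTree) : (mk t).size = t.size := by
  have h : Relation.EqvGen PlanarTree.Iso (mk t).rep t := Quotient.exact (mk_rep (mk t))
  rw [size]
  generalize (mk t).rep = s at h
  induction h with
  | rel _ _ h => exact h.size_eq
  | refl => rfl
  | symm _ _ _ ih => exact ih.symm
  | trans _ _ _ _ _ ih₁ ih₂ => exact ih₁.trans ih₂

end RTree

section GrowPrune

open MvPolynomial PlanarTree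

variable (k : Type*) [Field k]

/-- The monomial in `H_K` of a planar forest. -/
noncomputable def forestMonomial (l : List PlanarTree) : HK k :=
  (l.map fun a => X (RTree.mk a)).prod

@[simp]
theorem forestMonomial_nil : forestMonomial k [] = 1 := rfl

@[simp]
theorem forestMonomial_cons (a : PlanarTree) (l : List PlanarTree) :
    forestMonomial k (a :: l) = X (RTree.mk a) * forestMonomial k l := by
  simp [forestMonomial]

theorem forestMonomial_eq_of_perm {l m : List PlanarTree}
    (h : (l.map RTree.mk).Perm (m.map RTree.mk)) : forestMonomial k l = forestMonomial k m := by
  have := (h.map (X : RTree → HK k)).prod_eq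
  simpa [forestMonomial, Function.comp_def] using this

theorem forestMonomial_eq_monomial (l : List PlanarTree) :
    forestMonomial k l =
      monomial (Multiset.toFinsupp (l.map RTree.mk : List RTree)) (1 : k) := by
  induction l with
  | nil => simp
  | cons a l ih =>
    rw [forestMonomial_cons, ih, List.map_cons, ← Multiset.cons_coe, ← Multiset.singleton_add,
      map_add, Multiset.toFinsupp_singleton, X, monomial_mul, one_mul]

theorem span_forestMonomial : Submodule.span k (Set.range (forestMonomial k)) = ⊤ := by
  rw [eq_top_iff]
  rintro p -
  induction p using MvPolynomial.induction_on with
  | C a =>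
    rw [← mul_one (C a), ← smul_eq_C_mul]
    exact Submodule.smul_mem _ _ (Submodule.subset_span ⟨[], rfl⟩)
  | add p q hp hq => exact add_mem hp hq
  | mul_X p T hp =>
    induction hp using Submodule.span_induction with
    | mem x hx =>
      obtain ⟨l, rfl⟩ := hx
      refine Submodule.subset_span ⟨T.rep :: l, ?_⟩
      rw [forestMonomial_cons, RTree.mk_rep, mul_comm]
    | zero => simp
    | add x y _ _ hx hy => rw [add_mul]; exact add_mem hx hy
    | smul a x _ hx => rw [smul_mul_assoc]; exact Submodule.smul_mem _ _ hx

theorem hk_linearMap_ext {f g : HK k →ₗ[k] HK k}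
    (h : ∀ l, f (forestMonomial k l) = g (forestMonomial k l)) : f = g :=
  LinearMap.ext_on_range (span_forestMonomial k) h

/-- The operator `B₊` with values in `H_K`: joining the roots of a forest to a new root. -/
noncomputable def joinRoots : HK k →ₗ[k] HK k :=
  (basisMonomials RTree k).constr k fun d =>
    X (RTree.mk (node ((Finsupp.toMultiset d).toList.map RTree.rep)))

theorem joinRoots_forestMonomial (l : List PlanarTree) :
    joinRoots k (forestMonomial k l) = X (RTree.mk (node l)) := by
  rw [forestMonomial_eq_monomial, ← congrFun (coe_basisMonomials RTree k), joinRoots,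
    Module.Basis.constr_basis, Multiset.toFinsupp_toMultiset]
  congr 1
  rw [mk_node_eq_iff, List.map_map, show RTree.mk ∘ RTree.rep = id from funext RTree.mk_rep,
    List.map_id, ← Multiset.coe_eq_coe, Multiset.coe_toList]

theorem toHK_sum (L : List PlanarTree) :
    toHK k (L.map fun p => Finsupp.single (RTree.mk p) (1 : k)).sum =
      (L.map fun p => (X (RTree.mk p) : HK k)).sum := by
  simp [toHK, map_list_sum, Function.comp_def]

theorem sum_map_node (L : List (List PlanarTree)) :
    ((L.map node).map fun p => (X (RTree.mk p) : HK k)).sum =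
      joinRoots k (L.map (forestMonomial k)).sum := by
  simp [map_list_sum, Function.comp_def, joinRoots_forestMonomial]

theorem sum_map_cons (L : List PlanarTree) (l : List PlanarTree) :
    ((L.map (· :: l)).map (forestMonomial k)).sum =
      (L.map fun p => (X (RTree.mk p) : HK k)).sum * forestMonomial k l := by
  simp [Function.comp_def, List.sum_map_mul_right]

theorem sum_map_cons' (a : PlanarTree) (L : List (List PlanarTree)) :
    ((L.map (a :: ·)).map (forestMonomial k)).sum =
      X (RTree.mk a) * (L.map (forestMonomial k)).sum := by
  simp [Function.comp_def, List.sum_map_mul_left]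

theorem ND_X (T : RTree) :
    ND k (X T) = (T.rep.growList.map fun p => (X (RTree.mk p) : HK k)).sum := by
  rw [ND, mkDerivation_X, growF, toHK_sum]

theorem PD_X (T : RTree) :
    PD k (X T) = if T = RTree.bullet then 1 else
      (T.rep.pruneList.map fun p => (X (RTree.mk p) : HK k)).sum := by
  rw [PD, mkDerivation_X, pruneF, toHK_sum]

theorem ND_forestMonomial_of {l : List PlanarTree}
    (h : ∀ a ∈ l, ND k (X (RTree.mk a)) = (a.growList.map fun p => (X (RTree.mk p) : HK k)).sum) :
    ND k (forestMonomial k l) = ((graftAux (node []) l).map (forestMonomial k)).sum := by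
  induction l with
  | nil => simp [graftAux]
  | cons a l ih =>
    rw [forestMonomial_cons, Derivation.leibniz, h a (by simp),
      ih fun a ha => h a (List.mem_cons_of_mem _ ha), graftAux, List.map_append, List.sum_append,
      sum_map_cons, sum_map_cons', growList, smul_eq_mul, smul_eq_mul]
    ring

theorem sum_growList_of {l : List PlanarTree}
    (h : ∀ a ∈ l, ND k (X (RTree.mk a)) = (a.growList.map fun p => (X (RTree.mk p) : HK k)).sum) :
    ((node l).growList.map fun p => (X (RTree.mk p) : HK k)).sum =
      joinRoots k (X RTree.bullet * forestMonomial k l + ND k (forestMonomial k l)) := by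
  rw [ND_forestMonomial_of k h, growList, graftList, List.map_cons, List.sum_cons, sum_map_node,
    map_add, RTree.bullet, ← forestMonomial_cons, joinRoots_forestMonomial]

theorem ND_X_mk (t : PlanarTree) :
    ND k (X (RTree.mk t)) = (t.growList.map fun p => (X (RTree.mk p) : HK k)).sum := by
  induction hn : t.size using Nat.strong_induction_on generalizing t with
  | _ n ih =>
    subst hn
    rw [ND_X]
    have hs : (RTree.mk t).rep.size = t.size := RTree.size_mk t
    have hm := RTree.mk_rep (RTree.mk t)
    generalize (RTree.mk t).rep = s at hs hm
    obtain ⟨l⟩ := t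
    obtain ⟨m⟩ := s
    rw [sum_growList_of k fun a ha => ih _ (size_lt_of_mem ha) a rfl,
      sum_growList_of k fun a ha => ih _ (hs ▸ size_lt_of_mem ha) a rfl,
      forestMonomial_eq_of_perm k (mk_node_eq_iff.1 hm)]

theorem PD_forestMonomial_of {l : List PlanarTree}
    (h : ∀ a ∈ l, PD k (X (RTree.mk a)) = if RTree.mk a = RTree.bullet then 1 else
      (a.pruneList.map fun p => (X (RTree.mk p) : HK k)).sum) :
    PD k (forestMonomial k l) = ((pruneAux l).map (forestMonomial k)).sum := by
  induction l with
  | nil => simp [pruneAux]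
  | cons a l ih =>
    rw [forestMonomial_cons, Derivation.leibniz, h a (by simp),
      ih fun a ha => h a (List.mem_cons_of_mem _ ha), pruneAux_cons, List.map_append,
      List.sum_append, List.map_append, List.sum_append,
      sum_map_cons, sum_map_cons', smul_eq_mul, smul_eq_mul]
    obtain ⟨c⟩ := a
    split_ifs with hc
    · rw [mk_eq_bullet_iff] at hc
      subst hc
      simp [pruneList, pruneAux]
      ring
    · simp
      ring

theorem sum_pruneList_of {l : List PlanarTree}
    (h : ∀ a ∈ l, PD k (X (RTree.mk a)) = if RTree.mk a = RTree.bullet then 1 else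
      (a.pruneList.map fun p => (X (RTree.mk p) : HK k)).sum) :
    ((node l).pruneList.map fun p => (X (RTree.mk p) : HK k)).sum =
      joinRoots k (PD k (forestMonomial k l)) := by
  rw [PD_forestMonomial_of k h, pruneList, sum_map_node]

theorem PD_X_mk (t : PlanarTree) :
    PD k (X (RTree.mk t)) = if RTree.mk t = RTree.bullet then 1 else
      (t.pruneList.map fun p => (X (RTree.mk p) : HK k)).sum := by
  induction hn : t.size using Nat.strong_induction_on generalizing t with
  | _ n ih =>
    subst hn
    rw [PD_X]
    congr 1
    have hs : (RTree.mk t).rep.size = t.size := RTree.size_mk t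
    have hm := RTree.mk_rep (RTree.mk t)
    generalize (RTree.mk t).rep = s at hs hm
    obtain ⟨l⟩ := t
    obtain ⟨m⟩ := s
    rw [sum_pruneList_of k fun a ha => ih _ (size_lt_of_mem ha) a rfl,
      sum_pruneList_of k fun a ha => ih _ (hs ▸ size_lt_of_mem ha) a rfl,
      forestMonomial_eq_of_perm k (mk_node_eq_iff.1 hm)]

theorem ND_joinRoots (F : HK k) :
    ND k (joinRoots k F) = joinRoots k (X RTree.bullet * F + ND k F) := by
  have key : (ND k).toLinearMap ∘ₗ joinRoots k =
      joinRoots k ∘ₗ (LinearMap.mulLeft k (X RTree.bullet : HK k) + (ND k).toLinearMap) := by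
    refine hk_linearMap_ext k fun l => ?_
    rw [LinearMap.comp_apply, LinearMap.comp_apply, LinearMap.add_apply, LinearMap.mulLeft_apply,
      Derivation.coeFn_coe, joinRoots_forestMonomial, ND_X_mk, sum_growList_of k fun a _ => ND_X_mk k a]
  exact LinearMap.congr_fun key F

theorem PD_joinRoots (F : HK k) :
    PD k (joinRoots k F) = joinRoots k (PD k F) + C (constantCoeff F) := by
  refine LinearMap.congr_fun (f := (PD k).toLinearMap ∘ₗ joinRoots k)
    (g := joinRoots k ∘ₗ (PD k).toLinearMap +
      Algebra.linearMap k (HK k) ∘ₗ lcoeff k (0 : RTree →₀ ℕ))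
    (hk_linearMap_ext k fun l => ?_) F
  change PD k (joinRoots k (forestMonomial k l)) =
    joinRoots k (PD k (forestMonomial k l)) + C (constantCoeff (forestMonomial k l))
  rw [joinRoots_forestMonomial, PD_X_mk, sum_pruneList_of k fun a _ => PD_X_mk k a]
  cases l with
  | nil => simp [mk_eq_bullet_iff]
  | cons a l => simp [mk_eq_bullet_iff]

theorem constantCoeff_ND (F : HK k) : constantCoeff (ND k F) = 0 := by
  induction F using MvPolynomial.induction_on with
  | C a => rw [derivation_C, map_zero]
  | add p q hp hq => rw [map_add, map_add, hp, hq, add_zero]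
  | mul_X p T hp =>
    rw [Derivation.leibniz, map_add, smul_eq_mul, smul_eq_mul, map_mul, map_mul, hp, ND_X,
      map_list_sum]
    simp [Function.comp_def]

theorem DD_forestMonomial (l : List PlanarTree) :
    DD k (forestMonomial k l) = ((l.map PlanarTree.size).sum : k) • forestMonomial k l := by
  induction l with
  | nil => simp
  | cons a l ih =>
    rw [forestMonomial_cons, Derivation.leibniz, ih, DD, mkDerivation_X, RTree.size_mk]
    simp only [smul_eq_mul, List.map_cons, List.sum_cons, Nat.cast_add, smul_eq_C_mul, map_add]
    ring

theorem lie_PD_ND : ⁅PD k, ND k⁆ = DD k := by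
  refine MvPolynomial.derivation_ext fun T => ?_
  rw [← RTree.mk_rep T]
  generalize T.rep = t
  induction t using node_induction with
  | h l ih =>
    have hl : ⁅PD k, ND k⁆ (forestMonomial k l) = DD k (forestMonomial k l) := by
      clear T
      induction l with
      | nil => simp
      | cons a l ihl =>
        rw [forestMonomial_cons, Derivation.leibniz, Derivation.leibniz,
          ihl fun a ha => ih a (List.mem_cons_of_mem _ ha), ih a (by simp)]
    have hb : PD k (X RTree.bullet) = 1 := by rw [PD_X, if_pos rfl]
    rw [DD_forestMonomial, Derivation.commutator_apply] at hl
    rw [DD, mkDerivation_X, RTree.size_mk, Derivation.commutator_apply,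
      ← joinRoots_forestMonomial, ND_joinRoots, PD_joinRoots, PD_joinRoots, map_add (ND k),
      ND_joinRoots, derivation_C, map_add constantCoeff, constantCoeff_ND, map_mul,
      constantCoeff_X, zero_mul, add_zero, map_zero, add_zero, add_zero, ← map_sub, ← map_smul,
      map_add (PD k), Derivation.leibniz, hb]
    congr 1
    rw [size_node, Nat.cast_add, Nat.cast_one, add_smul, one_smul, ← hl]
    simp only [smul_eq_mul]
    ring

theorem mkDerivation_mem_HKcomp {f : RTree → HK k} {n m : ℕ}
    (hf : ∀ T : RTree, T.size ≤ n → ∃ e, f T ∈ HKcomp k e ∧ n - T.size + e = m)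
    {F : HK k} (hF : F ∈ HKcomp k n) : mkDerivation k f F ∈ HKcomp k m := by
  rw [F.as_sum, map_sum]
  refine sum_mem fun d hd => ?_
  have hd' : Finsupp.weight (fun T : RTree => T.size) d = n := hF (mem_support_iff.1 hd)
  rw [mkDerivation_monomial]
  refine Submodule.smul_mem _ _ (sum_mem fun T hT => ?_)
  have hle : Finsupp.single T 1 ≤ d := by
    rw [Finsupp.single_le_iff]
    exact Nat.one_le_iff_ne_zero.2 (Finsupp.mem_support_iff.1 hT)
  have hw : Finsupp.weight (fun T : RTree => T.size) (d - Finsupp.single T 1) + T.size = n := by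
    have := congrArg (Finsupp.weight fun T : RTree => T.size) (tsub_add_cancel_of_le hle)
    rwa [map_add, hd', Finsupp.weight_single, one_smul] at this
  obtain ⟨e, he, rfl⟩ := hf T (by omega)
  exact (isWeightedHomogeneous_monomial _ _ _ (by omega)).mul he

theorem sum_X_mem_HKcomp {L : List PlanarTree} {n : ℕ} (h : ∀ p ∈ L, p.size = n) :
    (L.map fun p => (X (RTree.mk p) : HK k)).sum ∈ HKcomp k n := by
  refine list_sum_mem fun x hx => ?_
  obtain ⟨p, hp, rfl⟩ := List.mem_map.1 hx
  rw [← h p hp, ← RTree.size_mk]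
  exact isWeightedHomogeneous_X k _ _

theorem ND_mem_HKcomp {n : ℕ} {F : HK k} (hF : F ∈ HKcomp k n) : ND k F ∈ HKcomp k (n + 1) := by
  refine mkDerivation_mem_HKcomp k (fun T hT => ⟨T.size + 1, ?_, by omega⟩) hF
  rw [growF, toHK_sum]
  refine sum_X_mem_HKcomp k fun p hp => ?_
  rw [size_of_mem_graftList p hp, size_node]
  rfl

theorem PD_mem_HKcomp {n : ℕ} {F : HK k} (hF : F ∈ HKcomp k (n + 1)) : PD k F ∈ HKcomp k n := by
  have hpos (T : RTree) : 1 ≤ T.size := T.rep.size_pos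
  refine mkDerivation_mem_HKcomp k
    (fun T hT => ⟨T.size - 1, ?_, by have := hpos T; omega⟩) hF
  split_ifs with h
  · rw [h, RTree.bullet, RTree.size_mk, size_node]
    exact isWeightedHomogeneous_one k _
  · rw [pruneF, toHK_sum]
    refine sum_X_mem_HKcomp k fun p hp => ?_
    have : p.size + 1 = T.size := size_of_mem_pruneList p hp
    omega

theorem PD_eq_zero_of_mem {F : HK k} (hF : F ∈ HKcomp k 0) : PD k F = 0 := by
  rw [F.as_sum, map_sum]
  refine Finset.sum_eq_zero fun d hd => ?_
  have hd' : Finsupp.weight (fun T : RTree => T.size) d = 0 := hF (mem_support_iff.1 hd)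
  have hw : Finsupp.NonTorsionWeight ℕ RTree.size :=
    Finsupp.nonTorsionWeight_of ℕ _ fun T : RTree => Nat.one_le_iff_ne_zero.1 T.rep.size_pos
  rw [Finsupp.weight_eq_zero_iff_eq_zero] at hd'
  rw [hd']
  exact derivation_C _ _

theorem DD_eq_smul_of_mem {n : ℕ} {F : HK k} (hF : F ∈ HKcomp k n) : DD k F = (n : k) • F := by
  conv_lhs => rw [F.as_sum]
  conv_rhs => rw [F.as_sum]
  rw [map_sum, Finset.smul_sum]
  refine Finset.sum_congr rfl fun d hd => ?_
  have hd' : Finsupp.weight (fun T : RTree => T.size) d = n := hF (mem_support_iff.1 hd)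
  generalize coeff d F = c
  rw [DD, mkDerivation_monomial, ← hd', Finsupp.weight_apply, Finsupp.sum, Finsupp.sum,
    Nat.cast_sum, Finset.sum_smul, Finset.smul_sum]
  refine Finset.sum_congr rfl fun T hT => ?_
  have hle : Finsupp.single T 1 ≤ d := by
    rw [Finsupp.single_le_iff]
    exact Nat.one_le_iff_ne_zero.2 (Finsupp.mem_support_iff.1 hT)
  rw [smul_eq_mul, X, smul_monomial, monomial_mul, tsub_add_cancel_of_le hle, smul_monomial,
    smul_monomial]
  simp only [smul_eq_mul, Nat.cast_mul, mul_one]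
  ring_nf

theorem PD_ND_eq {n : ℕ} {F : HK k} (hF : F ∈ HKcomp k n) :
    PD k (ND k F) = ND k (PD k F) + (n : k) • F := by
  rw [← DD_eq_smul_of_mem k hF, ← lie_PD_ND, Derivation.commutator_apply]
  ring

theorem iterate_ND_mem {n : ℕ} {F : HK k} (hF : F ∈ HKcomp k n) (j : ℕ) :
    (ND k)^[j] F ∈ HKcomp k (n + j) := by
  induction j with
  | zero => exact hF
  | succ j ih =>
    rw [Function.iterate_succ_apply']
    exact ND_mem_HKcomp k ih

/-- `N P F = -c F` forces `F = 0` for positive `c`, since `P` lowers the degree. -/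
theorem eq_zero_of_ND_PD [CharZero k] (n : ℕ) :
    ∀ {F : HK k} {c : ℕ}, F ∈ HKcomp k n → 1 ≤ c → ND k (PD k F) = -((c : k) • F) → F = 0 := by
  induction n with
  | zero =>
    intro F c hF hc h
    rw [PD_eq_zero_of_mem k hF, map_zero, eq_comm, neg_eq_zero, smul_eq_zero] at h
    exact h.resolve_left (by exact_mod_cast Nat.one_le_iff_ne_zero.1 hc)
  | succ n ih =>
    intro F c hF hc h
    have hP := PD_mem_HKcomp k hF
    have h₀ : PD k F = 0 := by
      refine ih (c := c + n) hP (by omega) ?_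
      have := PD_ND_eq k hP
      rw [h, map_neg, Derivation.map_smul] at this
      rw [eq_sub_of_add_eq this.symm, Nat.cast_add, add_smul]
      ring
    rw [h₀, map_zero, eq_comm, neg_eq_zero, smul_eq_zero] at h
    exact h.resolve_left (by exact_mod_cast Nat.one_le_iff_ne_zero.1 hc)

theorem exists_PD_iterate_ND {m : ℕ} (j : ℕ) :
    ∃ c : ℕ, m ≤ c ∧ (1 ≤ j → 1 ≤ c) ∧ ∀ {F : HK k}, F ∈ HKcomp k m →
      PD k ((ND k)^[j + 1] F) = (ND k)^[j + 1] (PD k F) + (c : k) • (ND k)^[j] F := by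
  induction j with
  | zero => exact ⟨m, le_rfl, by simp, fun hF => PD_ND_eq k hF⟩
  | succ j ih =>
    obtain ⟨c, hc, -, h⟩ := ih
    refine ⟨c + (m + (j + 1)), by omega, fun _ => by omega, fun {F} hF => ?_⟩
    rw [Function.iterate_succ_apply', PD_ND_eq k (iterate_ND_mem k hF (j + 1)), h hF, map_add,
      Derivation.map_smul, ← Function.iterate_succ_apply' (ND k), ← Function.iterate_succ_apply' (ND k) j F,
      add_assoc, Nat.cast_add c, add_smul (c : k)]

/-- Every `N^j F` of positive degree lies in the image of `P`. -/
theorem exists_PD_eq_iterate_ND [CharZero k] (m : ℕ) :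
    ∀ {F : HK k} (j : ℕ), F ∈ HKcomp k m → 1 ≤ m + j →
      ∃ G ∈ HKcomp k (m + j + 1), PD k G = (ND k)^[j] F := by
  induction m with
  | zero =>
    intro F j hF hj
    obtain ⟨c, -, hc, h⟩ := exists_PD_iterate_ND k (m := 0) j
    have hc' : (c : k) ≠ 0 := by exact_mod_cast Nat.one_le_iff_ne_zero.1 (hc (by omega))
    refine ⟨(c : k)⁻¹ • (ND k)^[j + 1] F,
      Submodule.smul_mem _ _ (iterate_ND_mem k hF (j + 1)), ?_⟩
    rw [Derivation.map_smul, h hF, PD_eq_zero_of_mem k hF, iterate_map_zero, zero_add, inv_smul_smul₀ hc']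
  | succ m ih =>
    intro F j hF hj
    obtain ⟨c, hc, -, h⟩ := exists_PD_iterate_ND k (m := m + 1) j
    have hc' : (c : k) ≠ 0 := by exact_mod_cast Nat.one_le_iff_ne_zero.1 (by omega)
    obtain ⟨G, hG, hGF⟩ := ih (j + 1) (PD_mem_HKcomp k hF) (by omega)
    refine ⟨(c : k)⁻¹ • ((ND k)^[j + 1] F - G), Submodule.smul_mem _ _
      (sub_mem (iterate_ND_mem k hF (j + 1)) ?_), ?_⟩
    · convert hG using 2
      omega
    · rw [Derivation.map_smul, map_sub, h hF, hGF, add_sub_cancel_left, inv_smul_smul₀ hc']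

end GrowPrune

/-- For `n ≥ 1`, `N` is injective on the degree-`n` component of `H_K`,
and `P` maps the degree-`n` component onto the degree-`(n-1)` component. -/
theorem stmt18 (k : Type*) [Field k] [CharZero k] (n : ℕ) (hn : 1 ≤ n) :
    Set.InjOn (ND k) (HKcomp k n : Set (HK k))
    ∧ ∀ y ∈ HKcomp k (n - 1), ∃ x ∈ HKcomp k n, PD k x = y := by
  constructor
  · intro x hx y hy h
    obtain ⟨n, rfl⟩ := Nat.exists_eq_add_of_le' hn
    have hxy := sub_mem hx hy
    rw [← sub_eq_zero]
    refine eq_zero_of_ND_PD k _ hxy hn ?_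
    have := PD_ND_eq k hxy
    rw [map_sub, h, sub_self, map_zero] at this
    exact eq_neg_of_add_eq_zero_left this.symm
  · intro y hy
    obtain ⟨n, rfl⟩ := Nat.exists_eq_add_of_le' hn
    rw [Nat.add_sub_cancel] at hy
    rcases n with _ | n
    · have hb : PD k (MvPolynomial.X RTree.bullet) = 1 := by rw [PD_X, if_pos rfl]
      have hs : RTree.bullet.size = 1 := by
        rw [RTree.bullet, RTree.size_mk, PlanarTree.size_node]
        rfl
      refine ⟨y * MvPolynomial.X RTree.bullet, ?_, ?_⟩
      · have := MvPolynomial.isWeightedHomogeneous_X k (fun T : RTree => T.size) RTree.bullet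
        rw [hs] at this
        exact MvPolynomial.IsWeightedHomogeneous.mul hy this
      · rw [Derivation.leibniz, hb, PD_eq_zero_of_mem k hy, smul_zero, add_zero, smul_eq_mul,
          mul_one]
    · exact exists_PD_eq_iterate_ND k (n + 1) 0 hy (by omega)
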